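/- Let γ > 1 and let Ω := {(x₁,x₂,x₃) ∈ ℝ³ : 0 < x₁, x₂ < 1 and 0 < x₃ < x₂^γ}. Let s ∈ ℝ satisfy max{−(γ+1)/2 − (γ−1), −(γ+1)/2 − 1} < s < −(γ+1)/2, and define v(x₁,x₂,x₃) := (0, −(s+1)x₃x₂^s, x₂^{s+1}). Then ∫_Ω |l(v)|² dx < ∞ and ∫_Q |v|² dx < ∞ for any cube Q with closure contained in Ω, while ∫_Ω |Dv|² dx = ∞. Consequently, there is no constant C such that ‖Dv‖_{L²(Ω)} ≤ C { ‖v‖_{L²(Q)} + ‖l(v)‖_{L²(Ω)} } holds for all v ∈ W^{1,2}(Ω, ℝ³); in particular the generalized Korn inequality fails on this (non-John) cuspidal domain. -/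

import Mathlib

open MeasureTheory Metric Set Matrix
open scoped BigOperators ENNReal

noncomputable section

abbrev Euc (n : ℕ) := EuclideanSpace ℝ (Fin n)

/-- Differential matrix `(Dv)_{ij} = ∂v_i/∂x_j` (computed via the Fréchet derivative). -/
def Dmat {n : ℕ} (v : Euc n → Euc n) (x : Euc n) : Matrix (Fin n) (Fin n) ℝ :=
  fun i j => fderiv ℝ v x (EuclideanSpace.single j 1) i

/-- Symmetric part of the differential matrix. -/
def epsMat {n : ℕ} (v : Euc n → Euc n) (x : Euc n) : Matrix (Fin n) (Fin n) ℝ :=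
  (1 / 2 : ℝ) • (Dmat v x + (Dmat v x)ᵀ)

/-- Trace-free part of the symmetric part of the differential matrix. -/
def lMat {n : ℕ} (v : Euc n → Euc n) (x : Euc n) : Matrix (Fin n) (Fin n) ℝ :=
  epsMat v x - (Matrix.trace (Dmat v x) / (n : ℝ)) • (1 : Matrix (Fin n) (Fin n) ℝ)

/-- Frobenius (Euclidean) norm of a matrix. -/
def matNorm {n : ℕ} (M : Matrix (Fin n) (Fin n) ℝ) : ℝ :=
  Real.sqrt (∑ i, ∑ j, (M i j) ^ 2)

/-- `M : N = Σ_{ij} M_{ij} N_{ij}`. -/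
def matDot {n : ℕ} (M N : Matrix (Fin n) (Fin n) ℝ) : ℝ := ∑ i, ∑ j, M i j * N i j

/-- Distance to the boundary of `Ω`. -/
def distBd {n : ℕ} (Ω : Set (Euc n)) (x : Euc n) : ℝ := Metric.infDist x (frontier Ω)

/-- Open axis-parallel cube with center `c` and side length `h`. -/
def openCube {n : ℕ} (c : Euc n) (h : ℝ) : Set (Euc n) := {x | ∀ i, |x i - c i| < h / 2}

/-- Closed axis-parallel cube with center `c` and side length `h`. -/
def closedCube {n : ℕ} (c : Euc n) (h : ℝ) : Set (Euc n) := {x | ∀ i, |x i - c i| ≤ h / 2}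

/-- Bounded John domain: there are `C > 1` and a distinguished point `x₀ ∈ Ω` such that
every point of `Ω` is joined to `x₀` by a rectifiable curve, parameterized by arc length
(hence 1-Lipschitz), along which the distance to the boundary grows linearly. -/
def IsJohnDomain {n : ℕ} (Ω : Set (Euc n)) : Prop :=
  ∃ C > (1 : ℝ), ∃ x₀ ∈ Ω, ∀ y ∈ Ω, ∃ L : ℝ, 0 ≤ L ∧ ∃ γ : ℝ → Euc n,
    γ 0 = y ∧ γ L = x₀ ∧ (∀ t ∈ Icc 0 L, γ t ∈ Ω) ∧
    (∀ s ∈ Icc 0 L, ∀ t ∈ Icc 0 L, dist (γ s) (γ t) ≤ |s - t|) ∧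
    (∀ t ∈ Icc 0 L, t / C ≤ Metric.infDist (γ t) (frontier Ω))

/-- The matrix-valued functions `H_i`. -/
def Hmat {n : ℕ} (i : Fin n) (z : Euc n) : Matrix (Fin n) (Fin n) ℝ :=
  fun j k => if j = k then z i else if k = i then z j else if j = i then -z k else 0

/-- The finite-dimensional space `V = D(Σ)`:
`φ(x) = A + λ I + Σ_i b_i H_i(x − y)` with `A` skew-symmetric. -/
def Vset (n : ℕ) : Set (Euc n → Matrix (Fin n) (Fin n) ℝ) :=
  {φ | ∃ (A : Matrix (Fin n) (Fin n) ℝ) (lam : ℝ) (b : Fin n → ℝ) (y : Euc n),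
    Aᵀ = -A ∧ ∀ x, φ x = A + lam • (1 : Matrix (Fin n) (Fin n) ℝ) + ∑ i, b i • Hmat i (x - y)}


/-- The cuspidal domain `Ω_γ ⊂ ℝ³`. -/
def cuspDomain (γ : ℝ) : Set (Euc 3) :=
  {x : Euc 3 | 0 < x 0 ∧ x 0 < 1 ∧ 0 < x 1 ∧ x 1 < 1 ∧ 0 < x 2 ∧ x 2 < x 1 ^ γ}

open Filter Topology

lemma measurableSet_cuspDomain (γ : ℝ) : MeasurableSet (cuspDomain γ) := by
  have m (i : Fin 3) : Measurable fun x : Euc 3 => x i := by fun_prop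
  exact (measurableSet_lt measurable_const (m 0)).inter
    ((measurableSet_lt (m 0) measurable_const).inter
      ((measurableSet_lt measurable_const (m 1)).inter
        ((measurableSet_lt (m 1) measurable_const).inter
          ((measurableSet_lt measurable_const (m 2)).inter
            (measurableSet_lt (m 2) ((m 1).pow_const γ))))))

/-- The coordinates of `ℝ³` as an iterated product. -/
def coordTriple (x : Euc 3) : ℝ × ℝ × ℝ := (x 0, x 1, x 2)

lemma measurePreserving_coordTriple : MeasurePreserving coordTriple :=
  ((MeasurePreserving.id (volume : Measure ℝ)).prod
    (volume_preserving_finTwoArrow ℝ)).comp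
    ((volume_preserving_piFinSuccAbove (fun _ : Fin 3 => ℝ) 0).comp
      (PiLp.volume_preserving_ofLp (Fin 3)))

/-- Integration over the cusp of a function of the second variable. -/
lemma lintegral_cuspDomain (γ : ℝ) {g : ℝ → ℝ≥0∞} (hg : Measurable g) :
    ∫⁻ x in cuspDomain γ, g (x 1) = ∫⁻ t in Ioo (0 : ℝ) 1, ENNReal.ofReal (t ^ γ) * g t := by
  have hR : MeasurableSet (regionBetween (fun _ => (0 : ℝ)) (fun t => t ^ γ) (Ioo (0 : ℝ) 1)) :=
    measurableSet_regionBetween measurable_const (by fun_prop) measurableSet_Ioo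
  have hset : cuspDomain γ = coordTriple ⁻¹'
      (Ioo (0 : ℝ) 1 ×ˢ regionBetween (fun _ => (0 : ℝ)) (fun t => t ^ γ) (Ioo (0 : ℝ) 1)) := by
    ext x
    simp [cuspDomain, coordTriple, regionBetween, and_assoc]
  calc ∫⁻ x in cuspDomain γ, g (x 1)
      = ∫⁻ p in Ioo (0 : ℝ) 1 ×ˢ regionBetween (fun _ => (0 : ℝ)) (fun t => t ^ γ) (Ioo (0 : ℝ) 1),
          g p.2.1 := by
        rw [hset]
        exact measurePreserving_coordTriple.setLIntegral_comp_preimage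
          (measurableSet_Ioo.prod hR) (f := fun p : ℝ × ℝ × ℝ => g p.2.1) (by fun_prop)
    _ = ∫⁻ q in regionBetween (fun _ => (0 : ℝ)) (fun t => t ^ γ) (Ioo (0 : ℝ) 1), g q.1 := by
        rw [Measure.volume_eq_prod, setLIntegral_prod _ (by fun_prop)]
        simp
    _ = ∫⁻ t, ∫⁻ y, (Ioo (0 : ℝ) 1).indicator (fun t => (Ioo 0 (t ^ γ)).indicator
          (fun _ => g t) y) t := by
        rw [← lintegral_indicator hR, Measure.volume_eq_prod,
          lintegral_prod _ (by fun_prop (disch := exact hR))]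
        refine lintegral_congr fun t => lintegral_congr fun y => ?_
        by_cases ht : t ∈ Ioo (0 : ℝ) 1 <;>
          simp only [indicator, regionBetween, mem_ofPred_eq, ht, true_and, false_and, if_true,
            if_false]
    _ = ∫⁻ t in Ioo (0 : ℝ) 1, ENNReal.ofReal (t ^ γ) * g t := by
        rw [← lintegral_indicator measurableSet_Ioo]
        refine lintegral_congr fun t => ?_
        by_cases ht : t ∈ Ioo (0 : ℝ) 1
        · simp only [indicator_of_mem ht]
          rw [lintegral_indicator_const measurableSet_Ioo, Real.volume_Ioo, sub_zero, mul_comm]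
        · simp [indicator_of_notMem ht]

/-- A power of the second variable is integrable over the cusp exactly as in one dimension. -/
lemma integrableOn_cuspDomain_rpow_iff (γ b : ℝ) :
    IntegrableOn (fun x : Euc 3 => x 1 ^ b) (cuspDomain γ) ↔ -1 < γ + b := by
  have key : ∫⁻ x in cuspDomain γ, ENNReal.ofReal (x 1 ^ b) =
      ∫⁻ t in Ioo (0 : ℝ) 1, ENNReal.ofReal (t ^ (γ + b)) := by
    rw [lintegral_cuspDomain γ (g := fun t => ENNReal.ofReal (t ^ b)) (by fun_prop)]
    refine setLIntegral_congr_fun measurableSet_Ioo fun t ht => ?_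
    rw [← ENNReal.ofReal_mul (Real.rpow_nonneg ht.1.le _), ← Real.rpow_add ht.1]
  have hm : AEStronglyMeasurable (fun x : Euc 3 => x 1 ^ b)
      (volume.restrict (cuspDomain γ)) := by
    have : Measurable (fun x : Euc 3 => x 1 ^ b) := by fun_prop
    exact this.aestronglyMeasurable
  have hm' : AEStronglyMeasurable (fun t : ℝ => t ^ (γ + b))
      (volume.restrict (Ioo (0 : ℝ) 1)) := by
    have : Measurable (fun t : ℝ => t ^ (γ + b)) := by fun_prop
    exact this.aestronglyMeasurable
  rw [← intervalIntegral.integrableOn_Ioo_rpow_iff one_pos, IntegrableOn, IntegrableOn,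
    Integrable, Integrable, and_iff_right hm, and_iff_right hm',
    hasFiniteIntegral_iff_ofReal, hasFiniteIntegral_iff_ofReal, key]
  · filter_upwards [ae_restrict_mem measurableSet_Ioo] with t ht
    exact Real.rpow_nonneg ht.1.le _
  · filter_upwards [ae_restrict_mem (measurableSet_cuspDomain γ)] with x hx
    exact Real.rpow_nonneg hx.2.2.1.le _

/-- The field `(0, -(s+1) x₃ x₂^s, x₂^(s+1))`, translated by `ε` in the second variable. -/
def kornField (s ε : ℝ) (x : Euc 3) : Euc 3 :=
  !₂[0, -(s + 1) * x 2 * (x 1 + ε) ^ s, (x 1 + ε) ^ (s + 1)]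

lemma hasFDerivAt_coord {n : ℕ} (i : Fin n) (x : Euc n) :
    HasFDerivAt (fun y : Euc n => y i) (EuclideanSpace.proj i : Euc n →L[ℝ] ℝ) x :=
  (EuclideanSpace.proj i : Euc n →L[ℝ] ℝ).hasFDerivAt

section kornField

variable {s ε : ℝ} {x : Euc 3}

lemma hasFDerivAt_kornField_one (h : 0 < x 1 + ε) :
    HasFDerivAt (fun y => kornField s ε y 1)
      ((-(s + 1) * x 2) • ((s * (x 1 + ε) ^ (s - 1)) • EuclideanSpace.proj (𝕜 := ℝ) (1 : Fin 3)) +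
        ((x 1 + ε) ^ s) • (-(s + 1)) • EuclideanSpace.proj (𝕜 := ℝ) (2 : Fin 3)) x := by
  have h1 := (hasFDerivAt_coord 1 x).add_const ε |>.rpow_const (p := s) (Or.inl h.ne')
  have h2 := (hasFDerivAt_coord 2 x).const_mul (-(s + 1))
  exact h2.mul h1

lemma hasFDerivAt_kornField_two (h : 0 < x 1 + ε) :
    HasFDerivAt (fun y => kornField s ε y 2)
      (((s + 1) * (x 1 + ε) ^ s) • EuclideanSpace.proj (𝕜 := ℝ) (1 : Fin 3)) x := by
  have h1 := (hasFDerivAt_coord 1 x).add_const ε |>.rpow_const (p := s + 1) (Or.inl h.ne')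
  rw [add_sub_cancel_right] at h1
  exact h1

lemma differentiableAt_kornField (h : 0 < x 1 + ε) : DifferentiableAt ℝ (kornField s ε) x := by
  rw [differentiableAt_euclidean]
  intro i
  fin_cases i
  · exact differentiableAt_const (0 : ℝ)
  · exact (hasFDerivAt_kornField_one h).differentiableAt
  · exact (hasFDerivAt_kornField_two h).differentiableAt

lemma Dmat_eq_of_hasFDerivAt {n : ℕ} {v : Euc n → Euc n} {x : Euc n} {i : Fin n}
    {f' : Euc n →L[ℝ] ℝ} (hv : DifferentiableAt ℝ v x)
    (h : HasFDerivAt (fun y => v y i) f' x) (j : Fin n) :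
    Dmat v x i j = f' (EuclideanSpace.single j 1) := by
  have := (hasFDerivAt_coord i (v x)).comp x hv.hasFDerivAt
  rw [h.unique this]
  rfl

lemma Dmat_kornField (h : 0 < x 1 + ε) :
    Dmat (kornField s ε) x =
      !![0, 0, 0;
        0, -((s + 1) * s * x 2 * (x 1 + ε) ^ (s - 1)), -((s + 1) * (x 1 + ε) ^ s);
        0, (s + 1) * (x 1 + ε) ^ s, 0] := by
  have hd := differentiableAt_kornField (s := s) h
  ext i j
  have h0 := Dmat_eq_of_hasFDerivAt (i := 0) hd (hasFDerivAt_const (0 : ℝ) x) j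
  have h1 := Dmat_eq_of_hasFDerivAt hd (hasFDerivAt_kornField_one h) j
  have h2 := Dmat_eq_of_hasFDerivAt hd (hasFDerivAt_kornField_two h) j
  fin_cases i
  · refine h0.trans ?_
    fin_cases j <;> simp
  · refine h1.trans ?_
    fin_cases j <;> simp <;> ring
  · refine h2.trans ?_
    fin_cases j <;> simp

lemma matNorm_sq {n : ℕ} (M : Matrix (Fin n) (Fin n) ℝ) :
    matNorm M ^ 2 = ∑ i, ∑ j, M i j ^ 2 :=
  Real.sq_sqrt (by positivity)

lemma matNorm_Dmat_kornField (h : 0 < x 1 + ε) :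
    matNorm (Dmat (kornField s ε) x) ^ 2 =
      ((s + 1) * s) ^ 2 * (x 2 ^ 2 * (x 1 + ε) ^ (2 * (s - 1))) +
        2 * (s + 1) ^ 2 * (x 1 + ε) ^ (2 * s) := by
  rw [matNorm_sq, Dmat_kornField h, mul_comm 2 (s - 1), mul_comm 2 s, Real.rpow_mul h.le,
    Real.rpow_mul h.le]
  simp [Fin.sum_univ_three]
  ring

lemma matNorm_lMat_kornField (h : 0 < x 1 + ε) :
    matNorm (lMat (kornField s ε) x) ^ 2 =
      2 / 3 * ((s + 1) * s) ^ 2 * (x 2 ^ 2 * (x 1 + ε) ^ (2 * (s - 1))) := by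
  rw [matNorm_sq, lMat, epsMat, Dmat_kornField h, mul_comm 2 (s - 1), Real.rpow_mul h.le]
  simp [Fin.sum_univ_three, Matrix.trace]
  ring

lemma norm_kornField_sq (h : 0 < x 1 + ε) :
    ‖kornField s ε x‖ ^ 2 =
      (s + 1) ^ 2 * (x 2 ^ 2 * (x 1 + ε) ^ (2 * s)) + (x 1 + ε) ^ (2 * (s + 1)) := by
  rw [EuclideanSpace.norm_sq_eq, mul_comm 2 s, mul_comm 2 (s + 1), Real.rpow_mul h.le,
    Real.rpow_mul h.le]
  simp [Fin.sum_univ_three, kornField]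
  ring

end kornField

section integrals

variable {γ ε b : ℝ}

lemma integrableOn_cuspDomain_of_le {f g : Euc 3 → ℝ} (hf : Measurable f)
    (hg : IntegrableOn g (cuspDomain γ)) (h0 : ∀ x ∈ cuspDomain γ, 0 ≤ f x)
    (h : ∀ x ∈ cuspDomain γ, f x ≤ g x) : IntegrableOn f (cuspDomain γ) := by
  refine Integrable.mono' hg hf.aestronglyMeasurable ?_
  filter_upwards [ae_restrict_mem (measurableSet_cuspDomain γ)] with x hx
  rw [Real.norm_of_nonneg (h0 x hx)]
  exact h x hx

lemma rpow_add_le_rpow {t : ℝ} (ht : 0 < t) (hε : 0 ≤ ε) (hb : b ≤ 0) :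
    (t + ε) ^ b ≤ t ^ b :=
  Real.rpow_le_rpow_of_nonpos ht (by linarith) hb

lemma integrableOn_cuspDomain_add_rpow (hγ : 0 ≤ γ) (hb : b ≤ 0)
    (h : -1 < γ + b ∧ ε = 0 ∨ 0 < ε) :
    IntegrableOn (fun x : Euc 3 => (x 1 + ε) ^ b) (cuspDomain γ) := by
  rcases h with ⟨h, rfl⟩ | h
  · simpa using (integrableOn_cuspDomain_rpow_iff γ b).2 h
  · have hc : IntegrableOn (fun x : Euc 3 => ε ^ b * x 1 ^ (0 : ℝ)) (cuspDomain γ) :=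
      ((integrableOn_cuspDomain_rpow_iff γ 0).2 (by linarith)).const_mul _
    refine integrableOn_cuspDomain_of_le (by fun_prop) hc
      (fun x hx => Real.rpow_nonneg (by linarith [hx.2.2.1]) _) fun x hx => ?_
    rw [Real.rpow_zero, mul_one]
    exact Real.rpow_le_rpow_of_nonpos h (by linarith [hx.2.2.1]) hb

lemma integrableOn_cuspDomain_sq_mul_add_rpow (hb : b ≤ 0) (hε : 0 ≤ ε)
    (h : -1 < 3 * γ + b) :
    IntegrableOn (fun x : Euc 3 => x 2 ^ 2 * (x 1 + ε) ^ b) (cuspDomain γ) := by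
  refine integrableOn_cuspDomain_of_le (by fun_prop)
    ((integrableOn_cuspDomain_rpow_iff γ (γ * 2 + b)).2 (by linarith)) ?_ ?_
  · intro x hx
    have := Real.rpow_nonneg (add_nonneg hx.2.2.1.le hε) b
    positivity
  · rintro x ⟨-, -, h1, -, h2, h3⟩
    rw [Real.rpow_add h1, Real.rpow_mul h1.le, Real.rpow_two]
    exact mul_le_mul (pow_le_pow_left₀ h2.le h3.le 2) (rpow_add_le_rpow h1 hε hb)
      (Real.rpow_nonneg (add_nonneg h1.le hε) _) (sq_nonneg _)

/-- A uniform bound on the integrals of the translated powers forces integrability at the cusp. -/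
lemma integrableOn_cuspDomain_rpow_of_bounded (hγ : 0 ≤ γ) (hb : b ≤ 0) {K : ℝ}
    (hK : ∀ ε > 0, ∫ x in cuspDomain γ, (x 1 + ε) ^ b ≤ K) :
    IntegrableOn (fun x : Euc 3 => x 1 ^ b) (cuspDomain γ) := by
  have hε (n : ℕ) : 0 < 1 / ((n : ℝ) + 1) := by positivity
  have hm : Measurable fun x : Euc 3 => x 1 ^ b := by fun_prop
  refine ⟨hm.aestronglyMeasurable, ?_⟩
  have hF (n : ℕ) : ∫⁻ x in cuspDomain γ, ‖((x : Euc 3) 1 + 1 / ((n : ℝ) + 1)) ^ b‖ₑ ≤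
      ENNReal.ofReal K := by
    rw [← ofReal_integral_norm_eq_lintegral_enorm
      (integrableOn_cuspDomain_add_rpow hγ hb (Or.inr (hε n)))]
    refine ENNReal.ofReal_le_ofReal (le_trans (le_of_eq ?_) (hK _ (hε n)))
    refine setIntegral_congr_fun (measurableSet_cuspDomain γ) fun x hx => ?_
    exact Real.norm_of_nonneg (Real.rpow_nonneg (add_pos hx.2.2.1 (hε n)).le _)
  have hlim : ∀ᵐ x ∂volume.restrict (cuspDomain γ),
      Tendsto (fun n : ℕ => (x 1 + 1 / ((n : ℝ) + 1)) ^ b) atTop (𝓝 (x 1 ^ b)) := by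
    filter_upwards [ae_restrict_mem (measurableSet_cuspDomain γ)] with x hx
    have h := (tendsto_one_div_add_atTop_nhds_zero_nat (𝕜 := ℝ)).const_add (x 1)
    rw [add_zero] at h
    exact h.rpow_const (Or.inl hx.2.2.1.ne')
  calc ∫⁻ x in cuspDomain γ, ‖(x : Euc 3) 1 ^ b‖ₑ
      = ∫⁻ x in cuspDomain γ,
          liminf (fun n : ℕ => ‖((x : Euc 3) 1 + 1 / ((n : ℝ) + 1)) ^ b‖ₑ) atTop :=
        lintegral_congr_ae (hlim.mono fun x hx => hx.enorm.liminf_eq.symm)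
    _ ≤ liminf (fun n : ℕ => ∫⁻ x in cuspDomain γ,
          ‖((x : Euc 3) 1 + 1 / ((n : ℝ) + 1)) ^ b‖ₑ) atTop :=
        lintegral_liminf_le fun n => by fun_prop
    _ ≤ ENNReal.ofReal K :=
        liminf_le_of_le (by isBoundedDefault) fun c hc =>
          hc.exists.elim fun n hn => hn.trans (hF n)
    _ < ⊤ := ENNReal.ofReal_lt_top

end integrals

/-- failure of the generalized Korn inequality on the cuspidal (non-John)
domain `Ω_γ`: for the field `v = (0, −(s+1)x₃x₂^s, x₂^{s+1})` one has `l(v) ∈ L²(Ω)` and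
`v ∈ L²(Q)` for every cube with closure in `Ω`, but `Dv ∉ L²(Ω)`; consequently there is
no constant `C` with `‖Dv‖_{L²(Ω)} ≤ C(‖v‖_{L²(Q)} + ‖l(v)‖_{L²(Ω)})` for all
`v ∈ W^{1,2}(Ω, ℝ³)`. -/
theorem generalized_korn_fails_on_cusp
    (γ s : ℝ) (hγ : 1 < γ)
    (hs_lb : max (-((γ + 1) / 2) - (γ - 1)) (-((γ + 1) / 2) - 1) < s)
    (hs_ub : s < -((γ + 1) / 2))
    (v : Euc 3 → Euc 3)
    (hv : ∀ x : Euc 3, v x 0 = 0 ∧ v x 1 = -(s + 1) * x 2 * x 1 ^ s ∧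
      v x 2 = x 1 ^ (s + 1)) :
    IntegrableOn (fun x => matNorm (lMat v x) ^ 2) (cuspDomain γ) ∧
    (∀ (c : Euc 3) (h : ℝ), 0 < h → closure (openCube c h) ⊆ cuspDomain γ →
      IntegrableOn (fun x => ‖v x‖ ^ 2) (openCube c h)) ∧
    ¬ IntegrableOn (fun x => matNorm (Dmat v x) ^ 2) (cuspDomain γ) ∧
    (∀ (c : Euc 3) (h : ℝ), 0 < h → closure (openCube c h) ⊆ cuspDomain γ →
      ¬ ∃ C : ℝ, ∀ u : Euc 3 → Euc 3,
        (∀ x ∈ cuspDomain γ, DifferentiableAt ℝ u x) →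
        IntegrableOn (fun x => ‖u x‖ ^ 2) (cuspDomain γ) →
        IntegrableOn (fun x => matNorm (Dmat u x) ^ 2) (cuspDomain γ) →
        (∫ x in cuspDomain γ, matNorm (Dmat u x) ^ 2) ^ (1 / 2 : ℝ) ≤
          C * ((∫ x in openCube c h, ‖u x‖ ^ 2) ^ (1 / 2 : ℝ) +
            (∫ x in cuspDomain γ, matNorm (lMat u x) ^ 2) ^ (1 / 2 : ℝ))) := by
  obtain rfl : v = kornField s 0 := by
    ext x i
    obtain ⟨h0, h1, h2⟩ := hv x
    fin_cases i
    · exact h0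
    · simpa [kornField] using h1
    · simpa [kornField] using h2
  clear hv
  obtain ⟨hs1, hs2⟩ := max_lt_iff.1 hs_lb
  have hγ0 : 0 ≤ γ := by linarith
  have hm := measurableSet_cuspDomain γ
  have hpos {ε : ℝ} (hε : 0 ≤ ε) {x : Euc 3} (hx : x ∈ cuspDomain γ) : 0 < x 1 + ε :=
    add_pos_of_pos_of_nonneg hx.2.2.1 hε
  have hs0 : 0 < 2 * (s + 1) ^ 2 := by nlinarith
  have hl {ε : ℝ} (hε : 0 ≤ ε) :
      IntegrableOn (fun x => matNorm (lMat (kornField s ε) x) ^ 2) (cuspDomain γ) :=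
    IntegrableOn.congr_fun ((integrableOn_cuspDomain_sq_mul_add_rpow (by linarith) hε
      (by linarith)).const_mul _) (fun x hx => (matNorm_lMat_kornField (hpos hε hx)).symm) hm
  have hn {ε : ℝ} (hε : 0 ≤ ε) :
      IntegrableOn (fun x => ‖kornField s ε x‖ ^ 2) (cuspDomain γ) :=
    IntegrableOn.congr_fun (((integrableOn_cuspDomain_sq_mul_add_rpow (by linarith) hε
      (by linarith)).const_mul _).add (integrableOn_cuspDomain_add_rpow hγ0 (by linarith)
        (hε.eq_or_lt'.imp_left fun h => ⟨by linarith, h⟩)))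
      (fun x hx => (norm_kornField_sq (hpos hε hx)).symm) hm
  have hD {ε : ℝ} (hε : 0 < ε) :
      IntegrableOn (fun x => matNorm (Dmat (kornField s ε) x) ^ 2) (cuspDomain γ) :=
    IntegrableOn.congr_fun (((integrableOn_cuspDomain_sq_mul_add_rpow (by linarith) hε.le
      (by linarith)).const_mul _).add ((integrableOn_cuspDomain_add_rpow hγ0 (by linarith)
        (Or.inr hε)).const_mul _))
      (fun x hx => (matNorm_Dmat_kornField (hpos hε.le hx)).symm) hm
  have hDle {ε : ℝ} (hε : 0 ≤ ε) {x : Euc 3} (hx : x ∈ cuspDomain γ) :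
      (x 1 + ε) ^ (2 * s) ≤
        (2 * (s + 1) ^ 2)⁻¹ * matNorm (Dmat (kornField s ε) x) ^ 2 := by
    rw [matNorm_Dmat_kornField (hpos hε hx), le_inv_mul_iff₀ hs0]
    have := Real.rpow_nonneg (hpos hε hx).le (2 * (s - 1))
    exact le_add_of_nonneg_left (by positivity)
  have hnot : ¬ IntegrableOn (fun x : Euc 3 => x 1 ^ (2 * s)) (cuspDomain γ) := by
    rw [integrableOn_cuspDomain_rpow_iff]
    linarith
  have hQ {c : Euc 3} {h : ℝ} (hc : closure (openCube c h) ⊆ cuspDomain γ) :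
      openCube c h ⊆ cuspDomain γ := subset_closure.trans hc
  refine ⟨hl le_rfl, fun c h _ hc => (hn le_rfl).mono_set (hQ hc), fun hint => hnot ?_, ?_⟩
  · refine integrableOn_cuspDomain_of_le (by fun_prop) (hint.const_mul (2 * (s + 1) ^ 2)⁻¹)
      (fun x hx => Real.rpow_nonneg hx.2.2.1.le _) fun x hx => ?_
    simpa using hDle le_rfl hx
  rintro c h - hc ⟨C, hC⟩
  set B : ℝ := |C| * ((∫ x in cuspDomain γ, ‖kornField s 0 x‖ ^ 2) ^ (1 / 2 : ℝ) +
    (∫ x in cuspDomain γ, matNorm (lMat (kornField s 0) x) ^ 2) ^ (1 / 2 : ℝ)) with hB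
  refine hnot (integrableOn_cuspDomain_rpow_of_bounded (K := (2 * (s + 1) ^ 2)⁻¹ * B ^ 2) hγ0
    (by linarith) fun ε hε => ?_)
  have hnε : ∫ x in openCube c h, ‖kornField s ε x‖ ^ 2 ≤
      ∫ x in cuspDomain γ, ‖kornField s 0 x‖ ^ 2 := by
    refine (setIntegral_mono_set (hn hε.le) (ae_of_all _ fun x => sq_nonneg _)
      (hQ hc).eventuallyLE).trans (setIntegral_mono_on (hn hε.le) (hn le_rfl) hm fun x hx => ?_)
    rw [norm_kornField_sq (hpos hε.le hx), norm_kornField_sq (hpos le_rfl hx), add_zero]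
    have h1 := rpow_add_le_rpow (b := 2 * s) hx.2.2.1 hε.le (by linarith)
    have h2 := rpow_add_le_rpow (b := 2 * (s + 1)) hx.2.2.1 hε.le (by linarith)
    gcongr
  have hlε : ∫ x in cuspDomain γ, matNorm (lMat (kornField s ε) x) ^ 2 ≤
      ∫ x in cuspDomain γ, matNorm (lMat (kornField s 0) x) ^ 2 := by
    refine setIntegral_mono_on (hl hε.le) (hl le_rfl) hm fun x hx => ?_
    rw [matNorm_lMat_kornField (hpos hε.le hx), matNorm_lMat_kornField (hpos le_rfl hx), add_zero]
    have h1 := rpow_add_le_rpow (b := 2 * (s - 1)) hx.2.2.1 hε.le (by linarith)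
    gcongr
  have hn0 : 0 ≤ ∫ x in openCube c h, ‖kornField s ε x‖ ^ 2 :=
    integral_nonneg fun x => sq_nonneg _
  have hl0 : 0 ≤ ∫ x in cuspDomain γ, matNorm (lMat (kornField s ε) x) ^ 2 :=
    integral_nonneg fun x => sq_nonneg _
  have hDB : ∫ x in cuspDomain γ, matNorm (Dmat (kornField s ε) x) ^ 2 ≤ B ^ 2 := by
    rw [← Real.sqrt_le_left (by positivity), Real.sqrt_eq_rpow]
    refine (hC (kornField s ε) (fun x hx => differentiableAt_kornField (hpos hε.le hx))
      (hn hε.le) (hD hε)).trans ?_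
    rw [hB]
    gcongr
    exact le_abs_self C
  calc ∫ x in cuspDomain γ, (x 1 + ε) ^ (2 * s)
      ≤ ∫ x in cuspDomain γ, (2 * (s + 1) ^ 2)⁻¹ * matNorm (Dmat (kornField s ε) x) ^ 2 :=
        setIntegral_mono_on (integrableOn_cuspDomain_add_rpow hγ0 (by linarith) (Or.inr hε))
          ((hD hε).const_mul _) hm fun x hx => hDle hε.le hx
    _ ≤ (2 * (s + 1) ^ 2)⁻¹ * B ^ 2 := by
        rw [integral_const_mul]
        gcongr

end
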